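/- Conditional on an A-served side-out game ending at score (α,β) with A scoring last, the probability generating function of the number of rallies D is G(z) = (p_a^α p_b^β / P) ∑_{j=0}^∞ q^j H(j) z^{α+β+2j}, where H(j) = ∑_{l=max(j-γ₁,0)}^{j} C(α+β+l-1, l) C(α, j-l) C(β-1, j-l-1), γ₁ = min(α,β), P is the probability of the conditioning event, and q = (1-p_a)(1-p_b). In particular, P[D = α+β+2j+1 | score (α,β), A scores last] = 0 for all j ≥ 0. -/

import Mathlib

open scoped BigOperators
open Filter

/-- Side-out scoring: a trajectory is the list of rally outcomes, `true` meaning that the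
current server wins the rally.  `soScorers srv g` is the list of scorers (`true` = player A),
where `srv` is the current server. -/
def soScorers : Bool → List Bool → List Bool
  | _, [] => []
  | srv, s :: rest => (if s then [srv] else []) ++ soScorers (if s then srv else !srv) rest

/-- Probability weight of a trajectory of rally outcomes: the server wins a rally with
probability `pa` (if A serves) or `pb` (if B serves); rallies are independent. -/
def soWeight (pa pb : ℝ) : Bool → List Bool → ℝ
  | _, [] => 1
  | srv, s :: rest =>
      (if srv then (if s then pa else 1 - pa) else (if s then pb else 1 - pb)) *
        soWeight pa pb (if s then srv else !srv) rest

/-- Points scored by player A (first server A). -/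
def soScoreA (g : List Bool) : ℕ := (soScorers true g).count true

/-- Points scored by player B (first server A). -/
def soScoreB (g : List Bool) : ℕ := (soScorers true g).count false

/-- The trajectory ends with a rally in which A scores a point. -/
def soLastA (g : List Bool) : Prop :=
  g.getLast? = some true ∧ (soScorers true g).getLast? = some true

/-- The trajectory ends with a rally in which B scores a point. -/
def soLastB (g : List Bool) : Prop :=
  g.getLast? = some true ∧ (soScorers true g).getLast? = some false

/-- Number of maximal runs of `false` in a list, the first argument being the previous value. -/
def falseRuns : Bool → List Bool → ℕ
  | _, [] => 0
  | prev, b :: rest => (if prev && !b then 1 else 0) + falseRuns b rest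

/-- Number of A-interruptions: maximal stretches in which B gains the serve from A and
scores at least one point, i.e. maximal blocks of points scored by B. -/
def soInter (g : List Bool) : ℕ := falseRuns true (soScorers true g)

/-- Number of exchanges: pairs of consecutive rallies in which a player gains the right to
serve and immediately loses it without scoring. -/
def exchCount : List Bool → ℕ
  | [] => 0
  | true :: rest => exchCount rest
  | [false] => 0
  | false :: true :: rest => exchCount rest
  | false :: false :: rest => 1 + exchCount rest

/-- Probability of a set of trajectories in the side-out model, first server A. -/
noncomputable def soPr (pa pb : ℝ) (E : Set (List Bool)) : ℝ :=
  ∑' g : List Bool, Set.indicator E (soWeight pa pb true) g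

/-- Conditional expectation of `f` given the event `E` in the side-out model, first server A. -/
noncomputable def soCondExp (pa pb : ℝ) (E : Set (List Bool)) (f : List Bool → ℝ) : ℝ :=
  (∑' g : List Bool, Set.indicator E (fun g => soWeight pa pb true g * f g) g) / soPr pa pb E

/-- Binomial coefficient with integer arguments, with the conventions `C(-1,-1) = 1` and
`C(m,k) = 0` whenever `k < 0` or `k > m` (except in the former case). -/
noncomputable def zchoose (m k : ℤ) : ℝ :=
  if m = -1 ∧ k = -1 then 1
  else if 0 ≤ k ∧ k ≤ m then ((m.toNat).choose k.toNat : ℝ) else 0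

theorem tsum_eq_tsum_card_fiber_mul {ι κ : Type*} (f : ι → ℝ) (φ : ι → κ) (c : κ → ℝ)
    (hfin : ∀ k, Finite {i // φ i = k}) (hf : ∀ i, f i = c (φ i)) :
    ∑' i, f i = ∑' k, (Nat.card {i // φ i = k} : ℝ) * c k := by
  let F : (Σ k, {i // φ i = k}) → ℝ := fun x => f x.2
  have hF : ∑' i, f i = ∑' x, F x := ((Equiv.sigmaFiberEquiv φ).tsum_eq f).symm
  have hfib (k : κ) : ∑' i : {i // φ i = k}, F ⟨k, i⟩ = (Nat.card {i // φ i = k} : ℝ) * c k := by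
    have : ∀ i : {i // φ i = k}, F ⟨k, i⟩ = c k := fun i => by
      simp only [F, hf, i.2]
    simp [this, tsum_const]
  have hfib' (k : κ) :
      ∑' i : {i // φ i = k}, |F ⟨k, i⟩| = |(Nat.card {i // φ i = k} : ℝ) * c k| := by
    have : ∀ i : {i // φ i = k}, |F ⟨k, i⟩| = |c k| := fun i => by
      simp only [F, hf, i.2]
    simp [this, tsum_const, abs_mul]
  have hsum : Summable F ↔ Summable fun k => (Nat.card {i // φ i = k} : ℝ) * c k := by
    rw [← summable_abs_iff, summable_sigma_of_nonneg fun _ => abs_nonneg _]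
    simp only [hfib']
    rw [summable_abs_iff, and_iff_right]
    intro k
    exact Summable.of_finite
  rw [hF]
  by_cases h : Summable F
  · rw [h.tsum_sigma]
    simp only [hfib]
  · rw [tsum_eq_zero_of_not_summable h, tsum_eq_zero_of_not_summable (mt hsum.2 h)]

theorem finite_setOf_length_eq_and (P : List Bool → Prop) (n : ℕ) :
    {g : List Bool | g.length = n ∧ P g}.Finite :=
  (List.finite_length_eq Bool n).subset fun _ h => h.1

theorem ncard_setOf_length_succ (P : List Bool → Prop) (n : ℕ) :
    {g : List Bool | g.length = n + 1 ∧ P g}.ncard =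
      {g : List Bool | g.length = n ∧ P (true :: g)}.ncard +
        {g : List Bool | g.length = n ∧ P (false :: g)}.ncard := by
  have hset : {g : List Bool | g.length = n + 1 ∧ P g} =
      List.cons true '' {g : List Bool | g.length = n ∧ P (true :: g)} ∪
        List.cons false '' {g : List Bool | g.length = n ∧ P (false :: g)} := by
    ext g
    cases g with
    | nil => simp
    | cons s g => cases s <;> simp
  rw [hset, Set.ncard_union_eq ?_ ((finite_setOf_length_eq_and _ n).image _)
    ((finite_setOf_length_eq_and _ n).image _)]
  · rw [Set.ncard_image_of_injective _ List.cons_injective,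
      Set.ncard_image_of_injective _ List.cons_injective]
  · rw [Set.disjoint_left]
    rintro _ ⟨g, -, rfl⟩ ⟨h, -, hh⟩
    simp at hh

/-- With `srv` serving first, the trajectory ends at score `(a, b)` with a point of A in its
last rally. -/
def SoEndsA (srv : Bool) (a b : ℕ) (g : List Bool) : Prop :=
  (soScorers srv g).count true = a ∧ (soScorers srv g).count false = b ∧
    g.getLast? = some true ∧ (soScorers srv g).getLast? = some true

theorem soScorers_ne_nil {g : List Bool} (srv : Bool) (h : g.getLast? = some true) :
    soScorers srv g ≠ [] := by
  induction g generalizing srv with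
  | nil => simp at h
  | cons s g ih =>
    cases s with
    | true => simp [soScorers]
    | false =>
      cases g with
      | nil => simp at h
      | cons t g =>
        rw [List.getLast?_cons_cons] at h
        simpa [soScorers] using ih (!srv) h

theorem not_soEndsA_nil (srv : Bool) (a b : ℕ) : ¬ SoEndsA srv a b [] := by
  simp [SoEndsA]

theorem not_soEndsA_zero (srv : Bool) (b : ℕ) (g : List Bool) : ¬ SoEndsA srv 0 b g := by
  rintro ⟨h, -, -, h'⟩
  exact List.count_eq_zero.1 h (List.mem_of_getLast? h')

theorem soEndsA_false_cons (srv : Bool) (a b : ℕ) (g : List Bool) :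
    SoEndsA srv a b (false :: g) ↔ SoEndsA (!srv) a b g := by
  cases g with
  | nil => simp [SoEndsA]
  | cons t g => simp [SoEndsA, soScorers]

theorem getLast?_cons_of_ne_nil {γ : Type*} (x : γ) {l : List γ} (h : l ≠ []) :
    (x :: l).getLast? = l.getLast? := by
  obtain ⟨y, l, rfl⟩ := List.exists_cons_of_ne_nil h
  exact List.getLast?_cons_cons

theorem soEndsA_true_true_cons (a b : ℕ) (g : List Bool) :
    SoEndsA true (a + 1) b (true :: g) ↔ (g = [] ∧ a = 0 ∧ b = 0) ∨ SoEndsA true a b g := by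
  rcases eq_or_ne g [] with rfl | hg
  · simp [SoEndsA, soScorers, eq_comm]
  · have hs : soScorers true (true :: g) = true :: soScorers true g := by simp [soScorers]
    simp only [SoEndsA, hs, getLast?_cons_of_ne_nil _ hg, hg, false_and, false_or,
      List.count_cons_self, Nat.add_right_cancel_iff]
    rw [List.count_cons_of_ne (by decide)]
    refine and_congr_right fun _ => and_congr_right fun _ => and_congr_right fun h => ?_
    rw [getLast?_cons_of_ne_nil _ (soScorers_ne_nil true h)]

theorem soEndsA_false_true_cons (a b : ℕ) (g : List Bool) :
    SoEndsA false a b (true :: g) ↔ ∃ b', b = b' + 1 ∧ SoEndsA false a b' g := by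
  rcases eq_or_ne g [] with rfl | hg
  · simp [SoEndsA, soScorers]
  · have hs : soScorers false (true :: g) = false :: soScorers false g := by simp [soScorers]
    simp only [SoEndsA, hs, getLast?_cons_of_ne_nil _ hg, List.count_cons_self]
    rw [List.count_cons_of_ne (by decide)]
    constructor
    · rintro ⟨h1, h2, h3, h4⟩
      rw [getLast?_cons_of_ne_nil _ (soScorers_ne_nil false h3)] at h4
      exact ⟨_, h2.symm, h1, rfl, h3, h4⟩
    · rintro ⟨b', rfl, h1, h2, h3, h4⟩
      rw [getLast?_cons_of_ne_nil _ (soScorers_ne_nil false h3)]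
      exact ⟨h1, by rw [h2], h3, h4⟩

theorem SoEndsA.exists_length_eq_and_soWeight_eq (pa pb : ℝ) {srv : Bool} {a b : ℕ}
    {g : List Bool} (h : SoEndsA srv a b g) :
    ∃ j, g.length = a + b + 2 * j + (if srv then 0 else 1) ∧
      soWeight pa pb srv g =
        pa ^ a * pb ^ b * ((1 - pa) * (1 - pb)) ^ j * (if srv then 1 else 1 - pb) := by
  induction g generalizing srv a b with
  | nil => exact absurd h (not_soEndsA_nil _ _ _)
  | cons s g ih =>
    cases s with
    | false =>
      rw [soEndsA_false_cons] at h
      obtain ⟨j, h1, h2⟩ := ih h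
      cases srv with
      | true =>
        refine ⟨j + 1, by simp at h1 ⊢; omega, ?_⟩
        simp [soWeight] at h2 ⊢
        rw [h2]; ring
      | false =>
        refine ⟨j, by simp at h1 ⊢; omega, ?_⟩
        simp [soWeight] at h2 ⊢
        rw [h2]; ring
    | true =>
      cases srv with
      | true =>
        obtain _ | a := a
        · exact absurd h (not_soEndsA_zero _ _ _)
        rw [soEndsA_true_true_cons] at h
        obtain ⟨rfl, rfl, rfl⟩ | h := h
        · exact ⟨0, by simp, by simp [soWeight]⟩
        obtain ⟨j, h1, h2⟩ := ih h
        refine ⟨j, by simp at h1 ⊢; omega, ?_⟩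
        simp [soWeight] at h2 ⊢
        rw [h2]; ring
      | false =>
        obtain ⟨b, rfl, hb⟩ := (soEndsA_false_true_cons _ _ _).1 h
        obtain ⟨j, h1, h2⟩ := ih hb
        refine ⟨j, by simp at h1 ⊢; omega, ?_⟩
        simp [soWeight] at h2 ⊢
        rw [h2]; ring

/-- The trajectories of length `n` with `srv` serving first that end at score `(a, b)` with a
point of A in the last rally. -/
def soEndsASet (srv : Bool) (a b n : ℕ) : Set (List Bool) :=
  {g | g.length = n ∧ SoEndsA srv a b g}

theorem soEndsASet_zero_left (srv : Bool) (b n : ℕ) : soEndsASet srv 0 b n = ∅ := by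
  simp [soEndsASet, not_soEndsA_zero]

theorem soEndsASet_eq_empty_of_lt {srv : Bool} {a b n : ℕ}
    (h : n < a + b + (if srv then 0 else 1)) : soEndsASet srv a b n = ∅ := by
  refine Set.eq_empty_of_forall_notMem fun g ⟨hg, hg'⟩ => ?_
  obtain ⟨j, hj, -⟩ := hg'.exists_length_eq_and_soWeight_eq 0 0
  omega

theorem ncard_soEndsASet_true_succ (a b n : ℕ) (h : n ≠ 0) :
    (soEndsASet true (a + 1) b (n + 1)).ncard =
      (soEndsASet true a b n).ncard + (soEndsASet false (a + 1) b n).ncard := by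
  simp only [soEndsASet]
  rw [ncard_setOf_length_succ]
  simp only [soEndsA_true_true_cons, soEndsA_false_cons, Bool.not_true]
  congr 2
  ext g
  simp only [Set.mem_ofPred_eq]
  refine and_congr_right fun hg => or_iff_right ?_
  rintro ⟨rfl, -⟩
  exact h hg.symm

theorem ncard_soEndsASet_true_one_zero_one : (soEndsASet true 1 0 1).ncard = 1 := by
  rw [Set.ncard_eq_one]
  refine ⟨[true], Set.ext fun g => ⟨fun ⟨h, h'⟩ => ?_, ?_⟩⟩
  · obtain ⟨s, rfl⟩ := List.length_eq_one_iff.1 h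
    simpa using h'.2.2.1
  · rintro rfl
    simp [soEndsASet, SoEndsA, soScorers]

theorem ncard_soEndsASet_false_zero (a n : ℕ) :
    (soEndsASet false a 0 (n + 1)).ncard = (soEndsASet true a 0 n).ncard := by
  simp only [soEndsASet]
  rw [ncard_setOf_length_succ]
  simp [soEndsA_false_true_cons, soEndsA_false_cons]

theorem ncard_soEndsASet_false_succ (a b n : ℕ) :
    (soEndsASet false a (b + 1) (n + 1)).ncard =
      (soEndsASet false a b n).ncard + (soEndsASet true a (b + 1) n).ncard := by
  simp only [soEndsASet]
  rw [ncard_setOf_length_succ]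
  simp [soEndsA_false_true_cons, soEndsA_false_cons]

theorem ncard_soEndsASet (n a b j : ℕ) :
    (n = a + 1 + b + 2 * j →
      (soEndsASet true (a + 1) b n).ncard = (a + j).choose j * (b + j - 1).choose b) ∧
    (n = a + 1 + b + 2 * j + 1 →
      (soEndsASet false (a + 1) b n).ncard = (a + j).choose j * (b + j).choose b) := by
  induction n generalizing a b j with
  | zero => omega
  | succ n ih =>
    constructor
    · intro hn
      rcases eq_or_ne n 0 with rfl | hn0
      · obtain rfl : a = 0 := by omega
        obtain rfl : b = 0 := by omega
        obtain rfl : j = 0 := by omega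
        simpa using ncard_soEndsASet_true_one_zero_one
      rw [ncard_soEndsASet_true_succ a b n hn0]
      have hB : (soEndsASet false (a + 1) b n).ncard =
          if j = 0 then 0 else (a + (j - 1)).choose (j - 1) * (b + (j - 1)).choose b := by
        obtain _ | j := j
        · rw [soEndsASet_eq_empty_of_lt (by simp; omega)]
          simp
        · rw [(ih a b j).2 (by omega)]
          simp
      have hA : (soEndsASet true a b n).ncard =
          if a = 0 then 0 else (a - 1 + j).choose j * (b + j - 1).choose b := by
        obtain _ | a := a
        · simp [soEndsASet_zero_left]
        · rw [(ih a b j).1 (by omega)]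
          simp
      rw [hA, hB]
      obtain _ | j := j
      · obtain _ | a := a
        · obtain _ | b := b
          · omega
          · simp
        · simp
      · obtain _ | a := a
        · simp
        · have h1 : a + 1 + (j + 1) = (a + 1 + j) + 1 := by ring
          have h2 : a + (j + 1) = a + 1 + j := by ring
          simp only [Nat.add_sub_cancel, h1, h2, Nat.choose_succ_succ (a + 1 + j) j,
            ← Nat.add_assoc, if_neg (Nat.succ_ne_zero _)]
          ring
    · intro hn
      obtain _ | b := b
      · rw [ncard_soEndsASet_false_zero, (ih a 0 j).1 (by omega)]
        simp
      · rw [ncard_soEndsASet_false_succ, (ih a b j).2 (by omega), (ih a (b + 1) j).1 (by omega)]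
        have h1 : b + 1 + j = (b + j) + 1 := by ring
        simp only [h1, Nat.add_sub_cancel, Nat.choose_succ_succ (b + j) b]
        ring

theorem sum_antidiagonal_shift_mul {R : Type*} [Semiring R] (u v : ℕ → R) (n : ℕ) :
    ∑ x ∈ Finset.HasAntidiagonal.antidiagonal n, (if x.1 = 0 then 0 else u (x.1 - 1)) * v x.2 =
      ∑ x ∈ Finset.HasAntidiagonal.antidiagonal n, u x.1 * (if x.2 = 0 then 0 else v (x.2 - 1)) := by
  cases n with
  | zero => simp
  | succ n =>
    rw [Finset.Nat.sum_antidiagonal_succ, Finset.Nat.sum_antidiagonal_succ']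
    simp

theorem cast_choose_succ_mul {R : Type*} [CommRing R] (n k : ℕ) :
    (n.choose (k + 1) : R) * (k + 1) = n.choose k * (n - k) := by
  rcases le_or_gt k n with h | h
  · have := congrArg (Nat.cast : ℕ → R) (Nat.choose_succ_right_eq n k)
    simpa [Nat.cast_sub h] using this
  · simp [Nat.choose_eq_zero_of_lt h, Nat.choose_eq_zero_of_lt (h.trans (Nat.lt_succ_self k))]

theorem sum_antidiagonal_choose_mul_choose_mul_choose_succ (a c i : ℕ) :
    (a + 1 : ℚ) * ∑ x ∈ Finset.HasAntidiagonal.antidiagonal i,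
        ((a + 2).choose (x.1 + 1) * c.choose x.1 * (a + c + 2 + x.2).choose x.2 : ℚ) =
      (i + a + 2) * ∑ x ∈ Finset.HasAntidiagonal.antidiagonal i,
        ((a + 1).choose (x.1 + 1) * c.choose x.1 * (a + c + 1 + x.2).choose x.2 : ℚ) := by
  have hT (s : ℕ) : (a + 1 : ℚ) * ((a + 2).choose (s + 1) * c.choose s) =
      (s + a + 2) * ((a + 1).choose (s + 1) * c.choose s) +
        (if s = 0 then 0 else ((c : ℚ) - ↑(s - 1)) *
          ((a + 1).choose (s - 1 + 1) * c.choose (s - 1))) := by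
    obtain _ | s := s
    · simp; ring
    · have h1 := cast_choose_succ_mul (R := ℚ) (a + 1) (s + 1)
      have h2 := cast_choose_succ_mul (R := ℚ) c s
      rw [Nat.choose_succ_succ (a + 1) (s + 1)]
      simp only [Nat.add_sub_cancel, if_neg (Nat.succ_ne_zero s)]
      push_cast at h1 ⊢
      linear_combination -(c.choose (s + 1) : ℚ) * h1 + ((a + 1).choose (s + 1) : ℚ) * h2
  have hP (s l : ℕ) : (s + a + 2 : ℚ) * (a + c + 2 + l).choose l +
      (c - s) * (if l = 0 then 0 else ((a + c + 2 + (l - 1)).choose (l - 1) : ℚ)) =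
        (s + l + a + 2) * (a + c + 1 + l).choose l := by
    obtain _ | l := l
    · simp
    · have h1 := cast_choose_succ_mul (R := ℚ) (a + c + 2 + l) l
      have e1 : a + c + 2 + (l + 1) = (a + c + 2 + l) + 1 := by ring
      have e2 : a + c + 1 + (l + 1) = a + c + 2 + l := by ring
      rw [e1, e2, Nat.choose_succ_succ (a + c + 2 + l) l]
      simp only [Nat.add_sub_cancel, if_neg (Nat.succ_ne_zero l)]
      push_cast at h1 ⊢
      linear_combination -h1
  have hshift := sum_antidiagonal_shift_mul
    (fun s => (c - s : ℚ) * ((a + 1).choose (s + 1) * c.choose s))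
    (fun l => ((a + c + 2 + l).choose l : ℚ)) i
  calc
    _ = ∑ x ∈ Finset.HasAntidiagonal.antidiagonal i, (x.1 + a + 2 : ℚ) *
            ((a + 1).choose (x.1 + 1) * c.choose x.1) * (a + c + 2 + x.2).choose x.2 +
          ∑ x ∈ Finset.HasAntidiagonal.antidiagonal i,
            (if x.1 = 0 then 0 else ((c : ℚ) - ↑(x.1 - 1)) *
              ((a + 1).choose (x.1 - 1 + 1) * c.choose (x.1 - 1))) *
              (a + c + 2 + x.2).choose x.2 := by
      rw [Finset.mul_sum, ← Finset.sum_add_distrib]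
      refine Finset.sum_congr rfl fun x _ => ?_
      linear_combination ((a + c + 2 + x.2).choose x.2 : ℚ) * hT x.1
    _ = _ := by
      rw [hshift, Finset.mul_sum, ← Finset.sum_add_distrib]
      refine Finset.sum_congr rfl fun x hx => ?_
      have hi : (i : ℚ) = x.1 + x.2 := by
        exact_mod_cast (Finset.HasAntidiagonal.mem_antidiagonal.1 hx).symm
      rw [hi]
      linear_combination ((a + 1).choose (x.1 + 1) * c.choose x.1 : ℚ) * hP x.1 x.2

theorem sum_antidiagonal_choose_mul_choose_mul_choose (a c i : ℕ) :
    ∑ x ∈ Finset.HasAntidiagonal.antidiagonal i,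
        (a + 1).choose (x.1 + 1) * c.choose x.1 * (a + c + 1 + x.2).choose x.2 =
      (a + i + 1).choose a * (c + 1 + i).choose i := by
  induction a with
  | zero =>
    rw [Finset.sum_eq_single (0, i)]
    · simp
    · rintro ⟨s, l⟩ hs hne
      obtain _ | s := s
      · simp_all
      · simp [Nat.choose_eq_zero_of_lt (show 1 < s + 1 + 1 by omega)]
    · simp
  | succ a ih =>
    have h := sum_antidiagonal_choose_mul_choose_mul_choose_succ a c i
    have h1 : (a + i + 2 : ℚ) * (a + i + 1).choose a = (a + i + 2).choose (a + 1) * (a + 1) := by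
      exact_mod_cast Nat.add_one_mul_choose_eq (a + i + 1) a
    have ih' := congrArg (Nat.cast : ℕ → ℚ) ih
    push_cast at ih'
    rw [ih'] at h
    have h0 : (a + 1 : ℚ) ≠ 0 := by positivity
    have e1 : a + 1 + i + 1 = a + i + 2 := by ring
    have e2 : a + 1 + c + 1 = a + c + 2 := by ring
    rw [e1, e2, ← Nat.cast_inj (R := ℚ)]
    push_cast
    apply mul_left_cancel₀ h0
    rw [h]
    linear_combination ((c + 1 + i).choose i : ℚ) * h1

theorem zchoose_natCast (m k : ℕ) : zchoose m k = m.choose k := by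
  rw [zchoose, if_neg (by omega)]
  split_ifs with h
  · simp
  · rw [Nat.choose_eq_zero_of_lt (by omega), Nat.cast_zero]

theorem zchoose_natCast_of_neg (m : ℕ) {k : ℤ} (hk : k < 0) : zchoose m k = 0 := by
  rw [zchoose, if_neg (by omega), if_neg (by omega)]

theorem zchoose_of_lt (m : ℕ) {k : ℤ} (hk : (m : ℤ) < k) : zchoose m k = 0 := by
  rw [zchoose, if_neg (by omega), if_neg (by omega)]

theorem sum_zchoose_eq (a β j : ℕ) :
    ∑ l ∈ Finset.Icc (j - min (a + 1) β) j,
        zchoose (((a + 1 : ℕ) : ℤ) + β + l - 1) (l : ℤ) *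
          zchoose ((a + 1 : ℕ) : ℤ) ((j : ℤ) - l) * zchoose ((β : ℤ) - 1) ((j : ℤ) - l - 1) =
      ((a + j).choose j * (β + j - 1).choose β : ℕ) := by
  have hfirst (l : ℕ) :
      zchoose (((a + 1 : ℕ) : ℤ) + β + l - 1) (l : ℤ) = (a + β + l).choose l := by
    rw [← zchoose_natCast]
    congr 1
    push_cast
    ring
  simp only [hfirst]
  obtain _ | c := β
  · have h1 : zchoose ((a + 1 : ℕ) : ℤ) ((j : ℤ) - j) = 1 := by
      simpa using zchoose_natCast (a + 1) 0
    have h2 : zchoose (((0 : ℕ) : ℤ) - 1) ((j : ℤ) - j - 1) = 1 := by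
      simp [zchoose]
    simp only [Nat.min_zero, Nat.sub_zero, Finset.Icc_self, Finset.sum_singleton, h1, h2]
    simp
  · have hc : (((c + 1 : ℕ) : ℤ) - 1) = (c : ℕ) := by push_cast; ring
    simp only [hc]
    have hsub : ∑ l ∈ Finset.Icc (j - min (a + 1) (c + 1)) j,
          ((a + (c + 1) + l).choose l : ℝ) * zchoose ((a + 1 : ℕ) : ℤ) ((j : ℤ) - l) *
            zchoose (c : ℤ) ((j : ℤ) - l - 1) =
        ∑ l ∈ Finset.range (j + 1),
          ((a + (c + 1) + l).choose l : ℝ) * zchoose ((a + 1 : ℕ) : ℤ) ((j : ℤ) - l) *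
            zchoose (c : ℤ) ((j : ℤ) - l - 1) := by
      refine Finset.sum_subset (fun l hl => ?_) fun l hl hl' => ?_
      · simp only [Finset.mem_Icc, Finset.mem_range] at hl ⊢
        omega
      · simp only [Finset.mem_Icc, Finset.mem_range] at hl hl'
        rcases le_total a c with h | h
        · rw [zchoose_of_lt (a + 1) (by omega)]
          simp
        · rw [zchoose_of_lt c (by omega)]
          simp
    rw [hsub, Finset.sum_range_succ, zchoose_natCast_of_neg c (by omega), mul_zero, add_zero]
    obtain _ | i := j
    · simp
    · have h1 : (a + (i + 1)).choose (i + 1) = (a + i + 1).choose a := by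
        rw [Nat.choose_symm_of_eq_add (by ring), Nat.add_assoc]
      have h2 : (c + 1 + (i + 1) - 1).choose (c + 1) = (c + 1 + i).choose i :=
        Nat.choose_symm_of_eq_add (by omega)
      rw [h1, h2, ← sum_antidiagonal_choose_mul_choose_mul_choose,
        ← Finset.Nat.sum_antidiagonal_swap, Finset.Nat.sum_antidiagonal_eq_sum_range_succ_mk]
      push_cast
      refine Finset.sum_congr rfl fun l hl => ?_
      have hl' : l ≤ i := by simpa [Nat.lt_succ_iff] using hl
      have e1 : (((i + 1 : ℕ) : ℤ) - l) = ((i - l + 1 : ℕ) : ℤ) := by omega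
      have e2 : (((i - l + 1 : ℕ) : ℤ) - 1) = ((i - l : ℕ) : ℤ) := by omega
      have e3 : a + (c + 1) + l = a + c + 1 + l := by ring
      simp only [Prod.fst_swap, Prod.snd_swap]
      rw [← Nat.cast_add_one i, ← Nat.cast_add_one a, e1, e2, e3, zchoose_natCast, zchoose_natCast]
      ring

theorem tsum_indicator_soEndsA (a β : ℕ) (pa pb z : ℝ) :
    ∑' g, Set.indicator {g | SoEndsA true (a + 1) β g}
        (fun g => soWeight pa pb true g * z ^ g.length) g =
      ∑' j : ℕ, ((a + j).choose j * (β + j - 1).choose β : ℕ) *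
        (pa ^ (a + 1) * pb ^ β * ((1 - pa) * (1 - pb)) ^ j * z ^ (a + 1 + β + 2 * j)) := by
  rw [← tsum_subtype]
  have e (j : ℕ) : {g : {g | SoEndsA true (a + 1) β g} // (g.1.length - (a + 1 + β)) / 2 = j} ≃
      soEndsASet true (a + 1) β (a + 1 + β + 2 * j) := by
    refine (Equiv.subtypeSubtypeEquivSubtypeInter _
      (fun g : List Bool => (g.length - (a + 1 + β)) / 2 = j)).trans
        (Equiv.subtypeEquivRight fun g => ?_)
    constructor
    · rintro ⟨h, h'⟩
      obtain ⟨k, hk, -⟩ := SoEndsA.exists_length_eq_and_soWeight_eq 0 0 h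
      simp only [if_true] at hk
      exact ⟨by omega, h⟩
    · rintro ⟨h, h'⟩
      exact ⟨h', by omega⟩
  rw [tsum_eq_tsum_card_fiber_mul _
    (fun g : {g | SoEndsA true (a + 1) β g} => (g.1.length - (a + 1 + β)) / 2)
    (fun j => pa ^ (a + 1) * pb ^ β * ((1 - pa) * (1 - pb)) ^ j * z ^ (a + 1 + β + 2 * j))
    (fun j => ?hfin) ?hf]
  case hfin =>
    have : Finite (soEndsASet true (a + 1) β (a + 1 + β + 2 * j)) :=
      finite_setOf_length_eq_and _ _
    exact Finite.of_equiv _ (e j).symm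
  case hf =>
    rintro ⟨g, hg⟩
    obtain ⟨k, hk, hw⟩ := SoEndsA.exists_length_eq_and_soWeight_eq pa pb hg
    simp only [if_true, mul_one, add_zero] at hk hw
    have : (a + 1 + β + 2 * k - (a + 1 + β)) / 2 = k := by omega
    simp only [hw, hk, this]
  refine tsum_congr fun j => ?_
  rw [← (ncard_soEndsASet _ a β j).1 rfl, ← Nat.card_coe_set_eq, Nat.card_congr (e j)]

theorem stmt_10 (α β : ℕ) (hα : 1 ≤ α) (pa pb : ℝ) (hpa0 : 0 < pa) (hpa1 : pa < 1)
    (hpb0 : 0 < pb) (hpb1 : pb < 1) (z : ℝ) (hz : |z| ≤ 1) :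
    (soCondExp pa pb {g : List Bool | soScoreA g = α ∧ soScoreB g = β ∧ soLastA g}
        (fun g => z ^ g.length) =
      pa ^ α * pb ^ β / soPr pa pb {g : List Bool | soScoreA g = α ∧ soScoreB g = β ∧ soLastA g} *
        (∑' j : ℕ, ((1 - pa) * (1 - pb)) ^ j *
          (∑ l ∈ Finset.Icc (j - min α β) j,
            zchoose ((α : ℤ) + β + l - 1) (l : ℤ) * zchoose (α : ℤ) ((j : ℤ) - l) *
              zchoose ((β : ℤ) - 1) ((j : ℤ) - l - 1)) *
          z ^ (α + β + 2 * j))) ∧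
    (∀ j : ℕ,
      soPr pa pb ({g : List Bool | soScoreA g = α ∧ soScoreB g = β ∧ soLastA g} ∩
          {g : List Bool | g.length = α + β + 2 * j + 1}) /
        soPr pa pb {g : List Bool | soScoreA g = α ∧ soScoreB g = β ∧ soLastA g} = 0) := by
  have hE : {g : List Bool | soScoreA g = α ∧ soScoreB g = β ∧ soLastA g} =
      {g | SoEndsA true α β g} := rfl
  obtain ⟨a, rfl⟩ := Nat.exists_eq_add_of_le' hα
  rw [hE]
  constructor
  · rw [soCondExp, tsum_indicator_soEndsA, div_mul_eq_mul_div, ← tsum_mul_left]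
    congr 1
    refine tsum_congr fun j => ?_
    rw [sum_zchoose_eq]
    ring
  · intro j
    have hempty : {g | SoEndsA true (a + 1) β g} ∩
        {g : List Bool | g.length = a + 1 + β + 2 * j + 1} = ∅ := by
      refine Set.eq_empty_of_forall_notMem fun g ⟨hg, hg'⟩ => ?_
      obtain ⟨k, hk, -⟩ := SoEndsA.exists_length_eq_and_soWeight_eq 0 0 hg
      simp only [Set.mem_ofPred_eq, if_true] at hg' hk
      omega
    simp [hempty, soPr]
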